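/- Assume (A2), (A3) and (A4), and set θ := min{ min_{1≤i≤n}(1 − ξ_i), min_{1≤j≤m}(1 − ζ_j) }, so θ > 0. Then for all (x¹, y¹), (x², y²) ∈ R^n × R^m the vector field of the FIIPNN satisfies the one-sided estimate Σ_{i=1}^n μ_i sgn(x²_i − x¹_i) (F₁,i(x², y²) − F₁,i(x¹, y¹)) + Σ_{j=1}^m τ_j sgn(y²_j − y¹_j) (F₂,j(x², y²) − F₂,j(x¹, y¹)) ≤ −θ ( Σ_{i=1}^n μ_i |x²_i − x¹_i| + Σ_{j=1}^m τ_j |y²_j − y¹_j| ). (This is the Lyapunov decrease estimate from which the global Mittag-Leffler stability of the FIIPNN is deduced.) -/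

import Mathlib

noncomputable def clamp (s c d : ℝ) : ℝ := min (max s c) d

noncomputable def sgn (t : ℝ) : ℝ := if 0 < t then 1 else if t < 0 then -1 else 0

theorem abs_clamp_sub_clamp_le (p q c d : ℝ) : |clamp p c d - clamp q c d| ≤ |p - q| :=
  (abs_min_sub_min_le_max _ _ _ _).trans <| by
    rw [sub_self, abs_zero, max_eq_left (abs_nonneg _)]
    refine (abs_max_sub_max_le_max _ _ _ _).trans ?_
    rw [sub_self, abs_zero, max_eq_left (abs_nonneg _)]

theorem sgn_mul_le_abs (t z : ℝ) : sgn t * z ≤ |z| := by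
  unfold sgn
  split_ifs
  · simpa using le_abs_self z
  · simpa using neg_le_abs z
  · simp

theorem sgn_mul_self (t : ℝ) : sgn t * t = |t| := by
  unfold sgn
  split_ifs with h₁ h₂
  · rw [abs_of_pos h₁, one_mul]
  · rw [abs_of_neg h₂, neg_one_mul]
  · rw [le_antisymm (not_lt.1 h₁) (not_lt.1 h₂)]; simp

/-- Signed increment of one component of the vector field, bounded by the absolute increments of
all the states. -/
theorem sgn_mul_component_sub_le {ι κ : Type*} [Fintype ι] [DecidableEq ι] [Fintype κ]
    (i : ι) (h W Wt : ι → ℝ) (Z Zt : κ → ℝ) (D e c d : ℝ)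
    (hi : 0 ≤ 1 - W i) (hD : 1 - W i ≤ D)
    (hW : ∀ j, |W j| ≤ Wt j) (hZ : ∀ k, |Z k| ≤ Zt k)
    (x₁ x₂ : ι → ℝ) (y₁ y₂ : κ → ℝ) :
    sgn (x₂ i - x₁ i) *
        (((∑ j, h j * x₂ j) +
            clamp (x₂ i - (∑ j, W j * x₂ j) - (∑ k, Z k * y₂ k) - e) c d - x₂ i)
          - ((∑ j, h j * x₁ j) +
            clamp (x₁ i - (∑ j, W j * x₁ j) - (∑ k, Z k * y₁ k) - e) c d - x₁ i))
      ≤ (D - 1 + |h i|) * |x₂ i - x₁ i|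
        + ∑ j ∈ Finset.univ.erase i, (Wt j + |h j|) * |x₂ j - x₁ j|
        + ∑ k, Zt k * |y₂ k - y₁ k| := by
  set p₂ := x₂ i - (∑ j, W j * x₂ j) - (∑ k, Z k * y₂ k) - e with hp₂
  set p₁ := x₁ i - (∑ j, W j * x₁ j) - (∑ k, Z k * y₁ k) - e with hp₁
  have hdiff : p₂ - p₁ = (1 - W i) * (x₂ i - x₁ i)
      - (∑ j ∈ Finset.univ.erase i, W j * (x₂ j - x₁ j)) - ∑ k, Z k * (y₂ k - y₁ k) := by
    have hsplit := Finset.add_sum_erase Finset.univ (fun j => W j * (x₂ j - x₁ j))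
      (Finset.mem_univ i)
    simp only [mul_sub, Finset.sum_sub_distrib] at hsplit ⊢
    rw [hp₂, hp₁]
    linarith
  have hclamp : sgn (x₂ i - x₁ i) * (clamp p₂ c d - clamp p₁ c d) ≤
      D * |x₂ i - x₁ i| + (∑ j ∈ Finset.univ.erase i, Wt j * |x₂ j - x₁ j|)
        + ∑ k, Zt k * |y₂ k - y₁ k| := by
    refine (sgn_mul_le_abs _ _).trans ((abs_clamp_sub_clamp_le _ _ _ _).trans ?_)
    rw [hdiff]
    refine (abs_sub _ _).trans (add_le_add ((abs_sub _ _).trans (add_le_add ?_ ?_)) ?_)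
    · rw [abs_mul, abs_of_nonneg hi]
      gcongr
    · refine (Finset.abs_sum_le_sum_abs _ _).trans (Finset.sum_le_sum fun j _ => ?_)
      rw [abs_mul]
      exact mul_le_mul_of_nonneg_right (hW j) (abs_nonneg _)
    · refine (Finset.abs_sum_le_sum_abs _ _).trans (Finset.sum_le_sum fun k _ => ?_)
      rw [abs_mul]
      exact mul_le_mul_of_nonneg_right (hZ k) (abs_nonneg _)
  have hlin : sgn (x₂ i - x₁ i) * ((∑ j, h j * x₂ j) - ∑ j, h j * x₁ j) ≤
      |h i| * |x₂ i - x₁ i| + ∑ j ∈ Finset.univ.erase i, |h j| * |x₂ j - x₁ j| := by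
    rw [Finset.add_sum_erase Finset.univ (fun j => |h j| * |x₂ j - x₁ j|) (Finset.mem_univ i)]
    refine (sgn_mul_le_abs _ _).trans ?_
    rw [← Finset.sum_sub_distrib]
    refine (Finset.abs_sum_le_sum_abs _ _).trans (Finset.sum_le_sum fun j _ => ?_)
    rw [← mul_sub, abs_mul]
  have hself := sgn_mul_self (x₂ i - x₁ i)
  simp only [add_mul, Finset.sum_add_distrib]
  linarith

/-- Weighted sum of the componentwise bounds over one layer, collected by state. -/
theorem sum_sgn_mul_layer_sub_le {ι κ : Type*} [Fintype ι] [DecidableEq ι] [Fintype κ]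
    (r : ℝ) (hr : 0 < r) (e c d : ι → ℝ) (L U A h : ι → ι → ℝ) (Ls Us As : ι → κ → ℝ)
    (hA : ∀ i j, L i j ≤ A i j ∧ A i j ≤ U i j)
    (hAs : ∀ i k, Ls i k ≤ As i k ∧ As i k ≤ Us i k)
    (hdiag : ∀ i, 1 - r * U i i ≥ h i i)
    (At : ι → ι → ℝ) (hAt : ∀ i j, At i j = max |r * L i j + h i j| |r * U i j + h i j|)
    (Ast : ι → κ → ℝ) (hAst : ∀ i k, Ast i k = max |Ls i k| |Us i k|)
    (w : ι → ℝ) (hw : ∀ i, 0 < w i)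
    (F : (ι → ℝ) → (κ → ℝ) → ι → ℝ)
    (hF : ∀ x y i, F x y i = (∑ j, h i j * x j)
        + clamp (x i - (∑ j, (r * A i j + h i j) * x j)
            - (∑ k, r * As i k * y k) - r * e i) (c i) (d i) - x i)
    (x₁ x₂ : ι → ℝ) (y₁ y₂ : κ → ℝ) :
    ∑ i, w i * sgn (x₂ i - x₁ i) * (F x₂ y₂ i - F x₁ y₁ i) ≤
      (∑ i, (w i * (-(r * L i i) - h i i + |h i i|)
          + ∑ j ∈ Finset.univ.erase i, w j * (At j i + |h j i|)) * |x₂ i - x₁ i|)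
        + ∑ k, (∑ i, w i * (r * Ast i k)) * |y₂ k - y₁ k| := by
  have hcomp : ∀ i, w i * sgn (x₂ i - x₁ i) * (F x₂ y₂ i - F x₁ y₁ i) ≤
      w i * (-(r * L i i) - h i i + |h i i|) * |x₂ i - x₁ i|
        + (∑ j ∈ Finset.univ.erase i, w i * (At i j + |h i j|) * |x₂ j - x₁ j|)
        + ∑ k, w i * (r * Ast i k) * |y₂ k - y₁ k| := by
    intro i
    have hU := mul_le_mul_of_nonneg_left (hA i i).2 hr.le
    have hL := mul_le_mul_of_nonneg_left (hA i i).1 hr.le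
    have hrow := sgn_mul_component_sub_le i (h i) (fun j => r * A i j + h i j) (At i)
      (fun k => r * As i k) (fun k => r * Ast i k) (1 - r * L i i - h i i) (r * e i) (c i) (d i)
      (by linarith [hdiag i]) (by linarith)
      (fun j => by
        rw [hAt]
        refine abs_le_max_abs_abs ?_ ?_
        · linarith [mul_le_mul_of_nonneg_left (hA i j).1 hr.le]
        · linarith [mul_le_mul_of_nonneg_left (hA i j).2 hr.le])
      (fun k => by
        rw [hAst, abs_mul, abs_of_pos hr]
        exact mul_le_mul_of_nonneg_left (abs_le_max_abs_abs (hAs i k).1 (hAs i k).2) hr.le)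
      x₁ x₂ y₁ y₂
    rw [← hF, ← hF] at hrow
    have hmul := mul_le_mul_of_nonneg_left hrow (hw i).le
    rw [mul_add, mul_add, Finset.mul_sum, Finset.mul_sum] at hmul
    simp only [← mul_assoc] at hmul ⊢
    linarith
  refine (Finset.sum_le_sum fun i _ => hcomp i).trans (le_of_eq ?_)
  simp only [add_mul, Finset.sum_add_distrib, Finset.sum_mul]
  congr 1
  · congr 1
    exact Finset.sum_comm' fun i j => by simp [eq_comm]
  · exact Finset.sum_comm

/-- Clearing the weight from the denominators of a contraction coefficient. -/
theorem weight_mul_coefficient_sub_one {ι κ : Type*} [DecidableEq ι] [Fintype ι] [Fintype κ]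
    (i : ι) (w p : ι → ℝ) (v q : κ → ℝ) (hw : 0 < w i) (s : ℝ) :
    w i * (1 + s + (∑ j ∈ Finset.univ.erase i, w j / w i * p j) + (∑ k, v k / w i * q k) - 1) =
      w i * s + (∑ j ∈ Finset.univ.erase i, w j * p j) + ∑ k, v k * q k := by
  have hp : w i * ∑ j ∈ Finset.univ.erase i, w j / w i * p j =
      ∑ j ∈ Finset.univ.erase i, w j * p j := by
    rw [Finset.mul_sum]
    exact Finset.sum_congr rfl fun j _ => by field_simp
  have hq : w i * ∑ k, v k / w i * q k = ∑ k, v k * q k := by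
    rw [Finset.mul_sum]
    exact Finset.sum_congr rfl fun k _ => by field_simp
  rw [← hp, ← hq]
  ring

theorem stmt6
    (n m : ℕ) (hn : 0 < n) (hm : 0 < m)
    (ρ lam : ℝ) (hρ : 0 < ρ) (hlam : 0 < lam)
    (a : Fin n → ℝ) (b : Fin m → ℝ)
    (Al Au A : Fin n → Fin n → ℝ)
    (Asl Asu As : Fin n → Fin m → ℝ)
    (hAb : ∀ i j, Al i j ≤ A i j ∧ A i j ≤ Au i j)
    (hAsb : ∀ i j, Asl i j ≤ As i j ∧ As i j ≤ Asu i j)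
    (Bl Bu B : Fin m → Fin m → ℝ)
    (Bsl Bsu Bs : Fin m → Fin n → ℝ)
    (hBb : ∀ i j, Bl i j ≤ B i j ∧ B i j ≤ Bu i j)
    (hBsb : ∀ j i, Bsl j i ≤ Bs j i ∧ Bs j i ≤ Bsu j i)
    (h : Fin n → Fin n → ℝ)
    (l : Fin m → Fin m → ℝ)
    (c1 c2 : Fin n → ℝ) (hc : ∀ i, c1 i ≤ c2 i)
    (d1 d2 : Fin m → ℝ) (hd : ∀ j, d1 j ≤ d2 j)
    (atil : Fin n → Fin n → ℝ)
    (hatil : ∀ j i, atil j i = max |ρ * Al j i + h j i| |ρ * Au j i + h j i|)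
    (astil : Fin n → Fin m → ℝ)
    (hastil : ∀ i j, astil i j = max |Asl i j| |Asu i j|)
    (btil : Fin m → Fin m → ℝ)
    (hbtil : ∀ i j, btil i j = max |lam * Bl i j + l i j| |lam * Bu i j + l i j|)
    (bstil : Fin m → Fin n → ℝ)
    (hbstil : ∀ j i, bstil j i = max |Bsl j i| |Bsu j i|)
    (hA2 : ∀ i, 1 - ρ * Au i i ≥ h i i)
    (hA3 : ∀ j, 1 - lam * Bu j j ≥ l j j)
    (μ : Fin n → ℝ) (τ : Fin m → ℝ)
    (hμ : ∀ i, 0 < μ i) (hτ : ∀ j, 0 < τ j)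
    (ξ : Fin n → ℝ)
    (hξdef : ∀ i, ξ i = 1 - ρ * Al i i - h i i + |h i i|
        + ∑ j ∈ Finset.univ.erase i, (μ j / μ i) * (atil j i + |h j i|)
        + ∑ j, (τ j / μ i) * (lam * bstil j i))
    (ζ : Fin m → ℝ)
    (hζdef : ∀ j, ζ j = 1 - lam * Bl j j - l j j + |l j j|
        + ∑ i ∈ Finset.univ.erase j, (τ i / τ j) * (btil i j + |l i j|)
        + ∑ i, (μ i / τ j) * (ρ * astil i j))
    (hA4 : (∀ i, 0 < ξ i ∧ ξ i < 1) ∧ (∀ j, 0 < ζ j ∧ ζ j < 1))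
    (F1 : (Fin n → ℝ) → (Fin m → ℝ) → Fin n → ℝ)
    (hF1 : ∀ x y i, F1 x y i = (∑ j, h i j * x j)
        + clamp (x i - (∑ j, (ρ * A i j + h i j) * x j)
            - (∑ j, ρ * As i j * y j) - ρ * a i) (c1 i) (c2 i) - x i)
    (F2 : (Fin n → ℝ) → (Fin m → ℝ) → Fin m → ℝ)
    (hF2 : ∀ x y j, F2 x y j = (∑ i, l j i * y i)
        + clamp (y j - (∑ i, (lam * B j i + l j i) * y i)
            - (∑ i, lam * Bs j i * x i) - lam * b j) (d1 j) (d2 j) - y j)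
    (θ : ℝ)
    (hθ : IsLeast (Set.range (fun i => 1 - ξ i) ∪ Set.range (fun j => 1 - ζ j)) θ)
    :
    0 < θ ∧
    ∀ (x1 x2 : Fin n → ℝ) (y1 y2 : Fin m → ℝ),
      (∑ i, μ i * sgn (x2 i - x1 i) * (F1 x2 y2 i - F1 x1 y1 i))
        + (∑ j, τ j * sgn (y2 j - y1 j) * (F2 x2 y2 j - F2 x1 y1 j))
        ≤ -θ * ((∑ i, μ i * |x2 i - x1 i|) + (∑ j, τ j * |y2 j - y1 j|)) := by
  refine ⟨?_, fun x1 x2 y1 y2 => ?_⟩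
  · obtain ⟨i, rfl⟩ | ⟨j, rfl⟩ := hθ.1
    · exact sub_pos.2 (hA4.1 i).2
    · exact sub_pos.2 (hA4.2 j).2
  have hlayer₁ := sum_sgn_mul_layer_sub_le ρ hρ a c1 c2 Al Au A h Asl Asu As hAb hAsb hA2
    atil hatil astil hastil μ hμ F1 hF1 x1 x2 y1 y2
  have hlayer₂ := sum_sgn_mul_layer_sub_le lam hlam b d1 d2 Bl Bu B l Bsl Bsu Bs hBb hBsb hA3
    btil hbtil bstil hbstil τ hτ (fun y x => F2 x y) (fun y x => hF2 x y) y1 y2 x1 x2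
  have hξ : ∀ i, (μ i * (-(ρ * Al i i) - h i i + |h i i|)
      + ∑ j ∈ Finset.univ.erase i, μ j * (atil j i + |h j i|))
        + ∑ j, τ j * (lam * bstil j i) ≤ -θ * μ i := by
    intro i
    rw [← weight_mul_coefficient_sub_one i μ _ τ _ (hμ i)]
    have hle : θ ≤ 1 - ξ i := hθ.2 (Or.inl ⟨i, rfl⟩)
    rw [hξdef] at hle
    rw [mul_comm (-θ)]
    exact mul_le_mul_of_nonneg_left (by linarith) (hμ i).le
  have hζ : ∀ j, (τ j * (-(lam * Bl j j) - l j j + |l j j|)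
      + ∑ i ∈ Finset.univ.erase j, τ i * (btil i j + |l i j|))
        + ∑ i, μ i * (ρ * astil i j) ≤ -θ * τ j := by
    intro j
    rw [← weight_mul_coefficient_sub_one j τ _ μ _ (hτ j)]
    have hle : θ ≤ 1 - ζ j := hθ.2 (Or.inr ⟨j, rfl⟩)
    rw [hζdef] at hle
    rw [mul_comm (-θ)]
    exact mul_le_mul_of_nonneg_left (by linarith) (hτ j).le
  have hx := Finset.sum_le_sum fun i (_ : i ∈ Finset.univ) =>
    mul_le_mul_of_nonneg_right (hξ i) (abs_nonneg (x2 i - x1 i))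
  have hy := Finset.sum_le_sum fun j (_ : j ∈ Finset.univ) =>
    mul_le_mul_of_nonneg_right (hζ j) (abs_nonneg (y2 j - y1 j))
  simp only [add_mul _ (∑ j, τ j * (lam * bstil j _)),
    add_mul _ (∑ i, μ i * (ρ * astil i _)), Finset.sum_add_distrib, mul_assoc (-θ),
    ← Finset.mul_sum] at hx hy
  rw [mul_add]
  linarith
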